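/- Let n ∈ ℕ, d : Fin n → ℤ, and let H ∈ M_n(ℂ) satisfy H i j = 0 whenever d i + d j ≠ 0. Suppose M ∈ M_n(ℂ) is d-triangular and preserves the hermitian pairing given by H, i.e., Mᴴ · H · M = H, where Mᴴ denotes the conjugate transpose. Then for every real number t one has ψ_t(M)ᴴ · H · ψ_t(M) = H; in particular (t = 0) the block-diagonal part of M also preserves the pairing. -/

import Mathlib

/-- A matrix `M` is `d`-triangular if `M i j = 0` whenever `d j < d i`. -/
def DTriangular {n : ℕ} (d : Fin n → ℤ) (M : Matrix (Fin n) (Fin n) ℂ) : Prop :=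
  ∀ i j, d j < d i → M i j = 0

/-- The deformation `ψ t` of a matrix: `ψ t M i j = t ^ (d j - d i) * M i j` when
`d i ≤ d j`, and `0` otherwise. -/
def psiDeform {n : ℕ} (d : Fin n → ℤ) (t : ℂ)
    (M : Matrix (Fin n) (Fin n) ℂ) : Matrix (Fin n) (Fin n) ℂ :=
  Matrix.of fun i j => if d i ≤ d j then t ^ (d j - d i).toNat * M i j else 0

open Matrix in
/-- Suppose the hermitian matrix `H` pairs degree `k` with degree `-k`
(`H i j = 0` unless `d i + d j = 0`), and `M` is a `d`-triangular matrix preserving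
the pairing, `Mᴴ * H * M = H`.  Then for every real `t` the deformed matrix
`ψ t M` still preserves the pairing: `(ψ t M)ᴴ * H * (ψ t M) = H`; in particular at
`t = 0` the block-diagonal part of `M` preserves the pairing. -/
theorem psiDeform_preserves_hermitian_pairing
    {n : ℕ} (d : Fin n → ℤ) (H M : Matrix (Fin n) (Fin n) ℂ)
    (hH : ∀ i j, d i + d j ≠ 0 → H i j = 0)
    (htri : DTriangular d M)
    (hM : Mᴴ * H * M = H) :
    ∀ t : ℝ, (psiDeform d (t : ℂ) M)ᴴ * H * (psiDeform d (t : ℂ) M) = H := by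
  intro t
  ext i j
  have key : ((psiDeform d (t : ℂ) M)ᴴ * H * (psiDeform d (t : ℂ) M)) i j
      = (t : ℂ) ^ (d i + d j).toNat * (Mᴴ * H * M) i j := by
    simp only [Matrix.mul_apply, Finset.sum_mul, Finset.mul_sum]
    refine Finset.sum_congr rfl fun l _ => Finset.sum_congr rfl fun k _ => ?_
    simp only [Matrix.conjTranspose_apply, psiDeform, Matrix.of_apply]
    by_cases hkl : d k + d l = 0
    · by_cases hk : d k ≤ d i
      · by_cases hl : d l ≤ d j
        · have e : (d i + d j).toNat = (d i - d k).toNat + (d j - d l).toNat := by omega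
          rw [if_pos hk, if_pos hl, e, pow_add]
          simp only [star_mul', star_pow, Complex.star_def, Complex.conj_ofReal]
          ring
        · simp [hl, htri l j (not_le.mp hl)]
      · simp [hk, htri k i (not_le.mp hk)]
    · simp [hH k l hkl]
  rw [key, hM]
  by_cases h : d i + d j = 0
  · simp [h]
  · simp [hH i j h]
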